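/- Suppose k = 0. Then conv(P) equals the polyhedron Q = {(x, y, z) ∈ ℝ^n × ℝ^n × ℝ^m : 0 ≤ x_i ≤ 1 and y_i ≥ 0 and y_i ≤ M_i x_i for all i ∈ N; z = 0; and for every ℓ ∈ N and every S ⊆ {1,…,ℓ} with S̄ = {1,…,ℓ}\S, Σ_{i∈S} y_i + Σ_{i∈S̄} (D_{σ_{ℓ(1)}} − D_{σ_{i−1(1)}}) x_i ≥ D_{σ_{ℓ(1)}}}, where D_{σ_{0(1)}} := 0. That is, when ε = 0 the proposed inequalities give the complete linear description of conv(P). -/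

import Mathlib

noncomputable section

/-- Cumulative demand of scenario `j` through periods `1,…,t`. -/
def cumD (d : ℕ → ℕ → ℝ) (j t : ℕ) : ℝ := ∑ i ∈ Finset.Icc 1 t, d j i

/-- Big-M constant `M_i = max_{j ∈ Ω} Σ_{p=i}^n d_{j p}`. -/
def bigM (d : ℕ → ℕ → ℝ) (n m i : ℕ) : ℝ :=
  sSup ((fun j => ∑ p ∈ Finset.Icc i n, d j p) '' Set.Icc 1 m)

/-- Membership in the feasible set `P` of the static probabilistic lot-sizing problem. -/
def memP (d : ℕ → ℕ → ℝ) (n m k : ℕ) (x y z : ℕ → ℝ) : Prop :=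
  (∀ i ∈ Finset.Icc 1 n, x i = 0 ∨ x i = 1) ∧
  (∀ i ∈ Finset.Icc 1 n, 0 ≤ y i) ∧
  (∀ j ∈ Finset.Icc 1 m, z j = 0 ∨ z j = 1) ∧
  (∀ t ∈ Finset.Icc 1 n, ∀ j ∈ Finset.Icc 1 m,
    cumD d j t * (1 - z j) ≤ ∑ i ∈ Finset.Icc 1 t, y i) ∧
  (∑ j ∈ Finset.Icc 1 m, z j ≤ (k : ℝ)) ∧
  (∀ i ∈ Finset.Icc 1 n, y i ≤ bigM d n m i * x i)

/-- The feasible set `P ⊆ ℝ^{2n+m}` as a set of points `(x, y, z)`; coordinates outside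
the index ranges are fixed to `0`. -/
def Pset (d : ℕ → ℕ → ℝ) (n m k : ℕ) : Set ((ℕ → ℝ) × (ℕ → ℝ) × (ℕ → ℝ)) :=
  {w | memP d n m k w.1 w.2.1 w.2.2 ∧
    (∀ i, i ∉ Finset.Icc 1 n → w.1 i = 0 ∧ w.2.1 i = 0) ∧
    (∀ j, j ∉ Finset.Icc 1 m → w.2.2 j = 0)}

/-! ### Sums over integer intervals -/

lemma sum_Icc_one_split (g : ℕ → ℝ) {i t : ℕ} (hi : 1 ≤ i) (hit : i ≤ t + 1) :
    ∑ u ∈ Finset.Icc 1 t, g u = ∑ u ∈ Finset.Icc 1 (i - 1), g u + ∑ u ∈ Finset.Icc i t, g u := by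
  rw [← Finset.sum_union]
  · congr 1
    ext u
    simp only [Finset.mem_union, Finset.mem_Icc]
    omega
  · rw [Finset.disjoint_left]
    intro u
    simp only [Finset.mem_Icc]
    omega

lemma sum_Icc_sub_pred (D : ℕ → ℝ) {i t : ℕ} (hi : 1 ≤ i) (hit : i ≤ t + 1) :
    ∑ u ∈ Finset.Icc i t, (D u - D (u - 1)) = D t - D (i - 1) := by
  induction t with
  | zero =>
    obtain rfl : i = 1 := by omega
    simp
  | succ t ih =>
    rcases hit.eq_or_lt with rfl | h
    · simp
    · rw [Finset.sum_Icc_succ_top (by omega), ih (by omega)]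
      simp

/-- Summation by parts on an interval. -/
lemma sum_Icc_by_parts (g D : ℕ → ℝ) {i t : ℕ} (hi : 1 ≤ i) (hit : i ≤ t + 1) :
    ∑ u ∈ Finset.Icc i t, (g u - g (u + 1)) * (D u - D (i - 1)) =
      ∑ u ∈ Finset.Icc i t, g u * (D u - D (u - 1)) - g (t + 1) * (D t - D (i - 1)) := by
  induction t with
  | zero =>
    obtain rfl : i = 1 := by omega
    simp
  | succ t ih =>
    rcases hit.eq_or_lt with rfl | h
    · simp
    · rw [Finset.sum_Icc_succ_top (by omega), Finset.sum_Icc_succ_top (by omega), ih (by omega)]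
      simp only [Nat.add_sub_cancel]
      ring

lemma sum_Icc_sub_succ (g : ℕ → ℝ) {i t : ℕ} (hit : i ≤ t + 1) :
    ∑ u ∈ Finset.Icc i t, (g u - g (u + 1)) = g i - g (t + 1) := by
  induction t with
  | zero =>
    have : i = 0 ∨ i = 1 := by omega
    rcases this with rfl | rfl <;> simp
  | succ t ih =>
    rcases hit.eq_or_lt with rfl | h
    · simp
    · rw [Finset.sum_Icc_succ_top (by omega), ih (by omega)]
      ring

/-! ### Uncapacitated lot sizing: dual greedy, primal solution, weak duality -/

/-- Greedy dual prices for uncapacitated lot sizing with cumulative demand `D`, unit production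
costs `p` and setup costs `f`: nonincreasing prices `s` such that every setup pays for itself
at most, and in every period with positive cumulative demand some setup is exactly paid for. -/
lemma exists_dual_prices {D p f : ℕ → ℝ} (hD : Monotone D) (hD0 : D 0 = 0)
    (hp : ∀ i, 0 ≤ p i) (hf : ∀ i, 0 ≤ f i) (t : ℕ) :
    ∃ s : ℕ → ℝ, Antitone s ∧ (∀ u, 0 ≤ s u) ∧ (∀ u, t ≤ u → s u = s t) ∧
      (∀ i, 1 ≤ i → ∑ u ∈ Finset.Icc i t, max (s u - p i) 0 * (D u - D (u - 1)) ≤ f i) ∧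
      ∀ v ≤ t, 0 < D v → ∃ i ∈ Finset.Icc 1 v, p i ≤ s v ∧
        ∑ u ∈ Finset.Icc i v, max (s u - p i) 0 * (D u - D (u - 1)) = f i := by
  induction t with
  | zero =>
    refine ⟨fun _ => 0, fun _ _ _ => le_rfl, fun _ => le_rfl, fun _ _ => rfl, ?_, ?_⟩
    · intro i hi
      rw [Finset.Icc_eq_empty (by omega)]
      simpa using hf i
    · intro v hv h
      obtain rfl : v = 0 := by omega
      simp [hD0] at h
  | succ t ih =>
    obtain ⟨s, hs, hs0, hst, hle, htight⟩ := ih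
    have hDpos : ∀ u, 0 ≤ D u := fun u => hD0 ▸ hD (Nat.zero_le u)
    have hdd : 0 ≤ D (t + 1) - D t := sub_nonneg.2 (hD (Nat.le_succ t))
    rcases hdd.eq_or_lt with hd | hd
    · refine ⟨s, hs, hs0, fun u hu => by rw [hst u (by omega), hst (t + 1) (by omega)], ?_, ?_⟩
      · intro i hi
        by_cases hit : i ≤ t + 1
        · rw [Finset.sum_Icc_succ_top hit, Nat.add_sub_cancel, ← hd, mul_zero, add_zero]
          exact hle i hi
        · rw [Finset.Icc_eq_empty (by omega)]
          simpa using hf i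
      · intro v hv hDv
        rcases hv.eq_or_lt with rfl | hv
        · obtain ⟨i, hi, hpi, hsum⟩ := htight t le_rfl (by linarith)
          rw [Finset.mem_Icc] at hi
          refine ⟨i, Finset.mem_Icc.2 ⟨hi.1, by omega⟩, by rw [hst (t + 1) (by omega)]; exact hpi, ?_⟩
          rw [Finset.sum_Icc_succ_top (by omega), Nat.add_sub_cancel, ← hd, mul_zero, add_zero]
          exact hsum
        · exact htight v (by omega) hDv
    · let slack : ℕ → ℝ := fun i =>
        f i - ∑ u ∈ Finset.Icc i t, max (s u - p i) 0 * (D u - D (u - 1))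
      have hslack : ∀ i, 1 ≤ i → 0 ≤ slack i := fun i hi => sub_nonneg.2 (hle i hi)
      obtain ⟨k, hk, hkmin⟩ := Finset.exists_min_image (Finset.Icc 1 (t + 1))
        (fun i => p i + slack i / (D (t + 1) - D t)) ⟨1, by simp⟩
      set c : ℝ := p k + slack k / (D (t + 1) - D t) with hc
      have hk1 := Finset.mem_Icc.1 hk
      have hpc : p k ≤ c := le_add_of_nonneg_right (div_nonneg (hslack k hk1.1) hd.le)
      have hc0 : 0 ≤ c := (hp k).trans hpc
      have hcs : 0 < D t → ∀ u ≤ t, c ≤ s u := by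
        intro hDt u hu
        obtain ⟨i, hi, hpi, hsum⟩ := htight t le_rfl hDt
        rw [Finset.mem_Icc] at hi
        have h1 := hkmin i (Finset.mem_Icc.2 ⟨hi.1, by omega⟩)
        have h2 : slack i = 0 := sub_eq_zero.2 hsum.symm
        simp only [h2, zero_div, add_zero] at h1
        exact h1.trans (hpi.trans (hs hu))
      let s' : ℕ → ℝ := fun u => if u ≤ t then max (s u) c else c
      have hs't : s' (t + 1) = c := by simp [s']
      have hterm : ∀ u, u ≤ t → ∀ i,
          max (s' u - p i) 0 * (D u - D (u - 1)) = max (s u - p i) 0 * (D u - D (u - 1)) := by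
        intro u hu i
        rcases (hDpos t).eq_or_lt with h0 | h0
        · have h1 : D u = 0 := le_antisymm (h0 ▸ hD hu) (hDpos u)
          have h2 : D (u - 1) = 0 := le_antisymm (h0 ▸ hD (by omega)) (hDpos _)
          simp [h1, h2]
        · simp [s', hu, max_eq_left (hcs h0 u hu)]
      have hsum' : ∀ i v, v ≤ t →
          ∑ u ∈ Finset.Icc i v, max (s' u - p i) 0 * (D u - D (u - 1)) =
          ∑ u ∈ Finset.Icc i v, max (s u - p i) 0 * (D u - D (u - 1)) := fun i v hv =>
        Finset.sum_congr rfl fun u hu => hterm u ((Finset.mem_Icc.1 hu).2.trans hv) i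
      refine ⟨s', ?_, ?_, ?_, ?_, ?_⟩
      · intro a b hab
        by_cases hb : b ≤ t
        · simp only [s', hb, hab.trans hb, if_true]
          exact max_le_max (hs hab) le_rfl
        · by_cases ha : a ≤ t <;> simp [s', hb, ha]
      · intro u
        by_cases hu : u ≤ t <;> simp [s', hu, hc0]
      · intro u hu
        rw [hs't]
        simp [s', show ¬ u ≤ t by omega]
      · intro i hi
        by_cases hit : i ≤ t + 1
        · rw [Finset.sum_Icc_succ_top hit, Nat.add_sub_cancel, hsum' i t le_rfl, hs't]
          have h1 : c ≤ p i + slack i / (D (t + 1) - D t) := hkmin i (Finset.mem_Icc.2 ⟨hi, hit⟩)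
          have h2 : max (c - p i) 0 ≤ slack i / (D (t + 1) - D t) :=
            max_le (by linarith) (div_nonneg (hslack i hi) hd.le)
          rw [le_div_iff₀ hd] at h2
          simp only [slack] at h2
          linarith
        · rw [Finset.Icc_eq_empty (by omega)]
          simpa using hf i
      · intro v hv hDv
        rcases hv.eq_or_lt with rfl | hv
        · refine ⟨k, hk, by rw [hs't]; exact hpc, ?_⟩
          rw [Finset.sum_Icc_succ_top hk1.2, Nat.add_sub_cancel, hsum' k t le_rfl, hs't,
            max_eq_left (by linarith)]
          have h1 : (c - p k) * (D (t + 1) - D t) = slack k := by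
            rw [hc, add_sub_cancel_left, div_mul_cancel₀ _ hd.ne']
          rw [h1]
          simp [slack]
        · obtain ⟨i, hi, hpi, hsum⟩ := htight v (by omega) hDv
          refine ⟨i, hi, ?_, by rw [hsum' i v (by omega), hsum]⟩
          simp only [s', show v ≤ t by omega, if_true]
          exact hpi.trans (le_max_left _ _)

/-- A zero-inventory-ordering plan whose cost is the value of the dual prices `s`. -/
lemma exists_plan_le_dual {D p f s : ℕ → ℝ} (hD : Monotone D) (hD0 : D 0 = 0)
    (hs : Antitone s) (hs0 : ∀ u, 0 ≤ s u) {n : ℕ}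
    (htight : ∀ v ≤ n, 0 < D v → ∃ i ∈ Finset.Icc 1 v, p i ≤ s v ∧
        ∑ u ∈ Finset.Icc i v, max (s u - p i) 0 * (D u - D (u - 1)) = f i) (t : ℕ) (ht : t ≤ n) :
    ∃ x y : ℕ → ℝ,
      (∀ i, (x i = 0 ∧ y i = 0) ∨ (x i = 1 ∧ ∃ v, i ≤ v ∧ v ≤ t ∧ y i = D v - D (i - 1))) ∧
      (∀ i, i ∉ Finset.Icc 1 t → x i = 0 ∧ y i = 0) ∧
      (∀ u ≤ t, D u ≤ ∑ i ∈ Finset.Icc 1 u, y i) ∧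
      ∑ i ∈ Finset.Icc 1 t, (f i * x i + p i * y i) ≤
        ∑ u ∈ Finset.Icc 1 t, s u * (D u - D (u - 1)) := by
  induction t using Nat.strong_induction_on with
  | _ t ih =>
    have hDpos : ∀ u, 0 ≤ D u := fun u => hD0 ▸ hD (Nat.zero_le u)
    rcases (hDpos t).eq_or_lt with h0 | h0
    · refine ⟨fun _ => 0, fun _ => 0, by simp, by simp, ?_, ?_⟩
      · intro u hu
        simpa using h0 ▸ hD hu
      · simp only [mul_zero, add_zero, Finset.sum_const_zero]
        exact Finset.sum_nonneg fun u _ =>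
          mul_nonneg (hs0 u) (sub_nonneg.2 (hD (Nat.sub_le u 1)))
    · obtain ⟨i, hi, hpi, hsum⟩ := htight t ht h0
      rw [Finset.mem_Icc] at hi
      obtain ⟨x, y, hxy, hout, hcov, hcost⟩ := ih (i - 1) (by omega) (by omega)
      have hxi := hout i (by simp only [Finset.mem_Icc]; omega)
      refine ⟨x + Pi.single i 1, y + Pi.single i (D t - D (i - 1)), ?_, ?_, ?_, ?_⟩
      · intro l
        by_cases hl : l = i
        · subst hl
          exact Or.inr ⟨by simp [hxi.1], t, hi.2, le_rfl, by simp [hxi.2]⟩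
        · rcases hxy l with h | ⟨h1, v, hv1, hv2, hv⟩
          · exact Or.inl (by simp [hl, h])
          · exact Or.inr ⟨by simp [hl, h1], v, hv1, by omega, by simp [hl, hv]⟩
      · intro l hl
        have hli : l ≠ i := by
          rintro rfl
          exact hl (Finset.mem_Icc.2 hi)
        have := hout l (by simp only [Finset.mem_Icc] at hl ⊢; omega)
        simp [hli, this]
      · intro u hu
        simp only [Pi.add_apply, Finset.sum_add_distrib]
        by_cases hui : u ≤ i - 1
        · have h1 : ∑ l ∈ Finset.Icc 1 u, (Pi.single i (D t - D (i - 1)) : ℕ → ℝ) l = 0 :=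
            Finset.sum_eq_zero fun l hl => by
              rw [Finset.mem_Icc] at hl
              exact Pi.single_eq_of_ne (by omega) _
          rw [h1, add_zero]
          exact hcov u hui
        · rw [Finset.sum_pi_single', if_pos (Finset.mem_Icc.2 ⟨hi.1, by omega⟩),
            sum_Icc_one_split y hi.1 (by omega : i ≤ u + 1),
            Finset.sum_eq_zero (s := Finset.Icc i u) (f := y) fun l hl =>
              (hout l (by simp only [Finset.mem_Icc] at hl ⊢; omega)).2]
          have := hcov (i - 1) le_rfl
          have := hD hu
          linarith
      · have h1 : ∀ l, f l * (x + Pi.single i 1 : ℕ → ℝ) l +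
              p l * (y + Pi.single i (D t - D (i - 1)) : ℕ → ℝ) l =
            (f l * x l + p l * y l) +
              (Pi.single i (f i + p i * (D t - D (i - 1))) : ℕ → ℝ) l := by
          intro l
          by_cases hl : l = i
          · subst hl
            simp only [Pi.add_apply, Pi.single_eq_same]
            ring
          · simp [hl]
        rw [Finset.sum_congr rfl fun l _ => h1 l, Finset.sum_add_distrib, Finset.sum_pi_single',
          if_pos (Finset.mem_Icc.2 hi),
          sum_Icc_one_split _ hi.1 (by omega : i ≤ t + 1),
          sum_Icc_one_split (fun u => s u * (D u - D (u - 1))) hi.1 (by omega : i ≤ t + 1),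
          Finset.sum_eq_zero (s := Finset.Icc i t) (f := fun l => f l * x l + p l * y l) fun l hl => by
            have := hout l (by simp only [Finset.mem_Icc] at hl ⊢; omega)
            simp [this]]
        have h2 : ∑ u ∈ Finset.Icc i t, max (s u - p i) 0 * (D u - D (u - 1)) =
            ∑ u ∈ Finset.Icc i t, s u * (D u - D (u - 1)) - p i * (D t - D (i - 1)) := by
          rw [← sum_Icc_sub_pred D hi.1 (by omega : i ≤ t + 1), Finset.mul_sum,
            ← Finset.sum_sub_distrib]
          refine Finset.sum_congr rfl fun u hu => ?_
          rw [max_eq_left (by linarith [hs (Finset.mem_Icc.1 hu).2])]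
          ring
        linarith

/-- Weak duality: any point satisfying the `(ℓ, S)` inequalities costs at least the value of
the dual prices `s`. -/
lemma dual_le_cost {D p f s x y : ℕ → ℝ} (hD0 : D 0 = 0)
    (hp : ∀ i, 0 ≤ p i) (hs : Antitone s) (hs0 : ∀ u, 0 ≤ s u) {n : ℕ}
    (hle : ∀ i, 1 ≤ i → ∑ u ∈ Finset.Icc i n, max (s u - p i) 0 * (D u - D (u - 1)) ≤ f i)
    (hx : ∀ i ∈ Finset.Icc 1 n, 0 ≤ x i) (hy : ∀ i ∈ Finset.Icc 1 n, 0 ≤ y i)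
    (hlS : ∀ l ∈ Finset.Icc 1 n, ∀ S ⊆ Finset.Icc 1 l,
      D l ≤ ∑ i ∈ S, y i + ∑ i ∈ Finset.Icc 1 l \ S, (D l - D (i - 1)) * x i) :
    ∑ u ∈ Finset.Icc 1 n, s u * (D u - D (u - 1)) ≤
      ∑ i ∈ Finset.Icc 1 n, (f i * x i + p i * y i) := by
  let g : ℕ → ℝ := fun u => if u ≤ n then s u else 0
  have hg : Antitone g := by
    intro a b hab
    by_cases hb : b ≤ n
    · simp only [g, hb, hab.trans hb, if_true]
      exact hs hab
    · by_cases ha : a ≤ n <;> simp [g, hb, ha, hs0]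
  have hgn : g (n + 1) = 0 := by simp [g]
  have hgs : ∀ u ≤ n, g u = s u := fun u hu => by simp [g, hu]
  have hmin : ∀ l ∈ Finset.Icc 1 n,
      D l ≤ ∑ i ∈ Finset.Icc 1 l, min (y i) ((D l - D (i - 1)) * x i) := by
    intro l hl
    refine (hlS l hl _ (Finset.filter_subset (fun i => y i ≤ (D l - D (i - 1)) * x i) _)).trans ?_
    rw [← Finset.filter_not, Finset.sum_filter, Finset.sum_filter, ← Finset.sum_add_distrib]
    refine Finset.sum_le_sum fun i _ => ?_
    by_cases h : y i ≤ (D l - D (i - 1)) * x i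
    · simp [h]
    · simp [h, (not_le.1 h).le]
  calc ∑ u ∈ Finset.Icc 1 n, s u * (D u - D (u - 1))
      = ∑ u ∈ Finset.Icc 1 n, (g u - g (u + 1)) * D u := by
        have := sum_Icc_by_parts g D le_rfl (by omega : 1 ≤ n + 1)
        simp only [Nat.sub_self, hD0, sub_zero, hgn, zero_mul] at this
        rw [this]
        exact Finset.sum_congr rfl fun u hu => by rw [hgs u (Finset.mem_Icc.1 hu).2]
    _ ≤ ∑ u ∈ Finset.Icc 1 n, ∑ i ∈ Finset.Icc 1 u,
          (g u - g (u + 1)) * min (y i) ((D u - D (i - 1)) * x i) := by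
        refine Finset.sum_le_sum fun u hu => ?_
        rw [← Finset.mul_sum]
        exact mul_le_mul_of_nonneg_left (hmin u hu) (sub_nonneg.2 (hg (Nat.le_succ u)))
    _ = ∑ i ∈ Finset.Icc 1 n, ∑ u ∈ Finset.Icc i n,
          (g u - g (u + 1)) * min (y i) ((D u - D (i - 1)) * x i) := by
        refine Finset.sum_comm' fun u i => ?_
        simp only [Finset.mem_Icc]
        omega
    _ ≤ ∑ i ∈ Finset.Icc 1 n, (f i * x i + p i * y i) := by
        refine Finset.sum_le_sum fun i hi => ?_
        have hin := Finset.mem_Icc.1 hi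
        have hit : i ≤ n + 1 := by omega
        have hterm : ∀ u, (g u - g (u + 1)) * min (y i) ((D u - D (i - 1)) * x i) ≤
            (max (g u - p i) 0 - max (g (u + 1) - p i) 0) * (D u - D (i - 1)) * x i +
              (min (g u) (p i) - min (g (u + 1)) (p i)) * y i := by
          intro u
          have h0 := hg (Nat.le_succ u)
          have h1 : 0 ≤ max (g u - p i) 0 - max (g (u + 1) - p i) 0 :=
            sub_nonneg.2 (max_le_max (by linarith) le_rfl)
          have h2 : 0 ≤ min (g u) (p i) - min (g (u + 1)) (p i) :=
            sub_nonneg.2 (min_le_min h0 le_rfl)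
          have h3 : ∀ a b : ℝ, max (a - b) 0 + min a b = a := by
            intro a b
            rcases le_total a b with h | h <;> simp [h]
          have h4 : g u - g (u + 1) = (max (g u - p i) 0 - max (g (u + 1) - p i) 0) +
              (min (g u) (p i) - min (g (u + 1)) (p i)) := by
            linarith [h3 (g u) (p i), h3 (g (u + 1)) (p i)]
          rw [h4, add_mul, mul_assoc]
          exact add_le_add (mul_le_mul_of_nonneg_left (min_le_right _ _) h1)
            (mul_le_mul_of_nonneg_left (min_le_left _ _) h2)
        refine (Finset.sum_le_sum fun u _ => hterm u).trans ?_
        rw [Finset.sum_add_distrib, ← Finset.sum_mul, ← Finset.sum_mul,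
          sum_Icc_by_parts (fun u => max (g u - p i) 0) D hin.1 hit,
          sum_Icc_sub_succ (fun u => min (g u) (p i)) hit]
        simp only [hgn, zero_sub, max_eq_right (neg_nonpos.2 (hp i)), zero_mul, sub_zero,
          min_eq_left (hp i)]
        refine add_le_add (mul_le_mul_of_nonneg_right ?_ (hx i hi))
          (mul_le_mul_of_nonneg_right (min_le_right _ _) (hy i hi))
        refine le_trans (le_of_eq ?_) (hle i hin.1)
        exact Finset.sum_congr rfl fun u hu => by rw [hgs u (Finset.mem_Icc.1 hu).2]

/-- Optimizing an arbitrary linear functional over points satisfying the `(ℓ, S)` inequalities: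
an integral plan with production levels from a finite list does at least as well. -/
lemma exists_plan_le {D M : ℕ → ℝ} (hD : Monotone D) (hD0 : D 0 = 0) {n : ℕ}
    (hM : ∀ i ∈ Finset.Icc 1 n, D n - D (i - 1) ≤ M i) (c q : ℕ → ℝ) {x y : ℕ → ℝ}
    (hx : ∀ i ∈ Finset.Icc 1 n, 0 ≤ x i) (hx1 : ∀ i ∈ Finset.Icc 1 n, x i ≤ 1)
    (hy : ∀ i ∈ Finset.Icc 1 n, 0 ≤ y i) (hyM : ∀ i ∈ Finset.Icc 1 n, y i ≤ M i * x i)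
    (hlS : ∀ l ∈ Finset.Icc 1 n, ∀ S ⊆ Finset.Icc 1 l,
      D l ≤ ∑ i ∈ S, y i + ∑ i ∈ Finset.Icc 1 l \ S, (D l - D (i - 1)) * x i) :
    ∃ X Y : ℕ → ℝ, (∀ i ∈ Finset.Icc 1 n, X i = 0 ∨ X i = 1) ∧
      (∀ i ∈ Finset.Icc 1 n, 0 ≤ Y i) ∧ (∀ i ∈ Finset.Icc 1 n, Y i ≤ M i * X i) ∧
      (∀ i ∈ Finset.Icc 1 n, Y i = 0 ∨ Y i = M i ∨ ∃ v ≤ n, Y i = D v - D (i - 1)) ∧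
      (∀ i, i ∉ Finset.Icc 1 n → X i = 0 ∧ Y i = 0) ∧
      (∀ t ∈ Finset.Icc 1 n, D t ≤ ∑ i ∈ Finset.Icc 1 t, Y i) ∧
      ∑ i ∈ Finset.Icc 1 n, (c i * X i + q i * Y i) ≤
        ∑ i ∈ Finset.Icc 1 n, (c i * x i + q i * y i) := by
  let a : ℕ → ℝ := fun i => c i + min (q i) 0 * M i
  let p : ℕ → ℝ := fun i => max (q i) 0
  let f : ℕ → ℝ := fun i => max (a i) 0
  have hp : ∀ i, 0 ≤ p i := fun i => le_max_right _ _
  have hf : ∀ i, 0 ≤ f i := fun i => le_max_right _ _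
  obtain ⟨s, hs, hs0, -, hle, htight⟩ := exists_dual_prices hD hD0 hp hf n
  obtain ⟨X, Y, hXY, hout, hcov, hcost⟩ :=
    exists_plan_le_dual hD hD0 hs hs0 htight n le_rfl
  have hcost' := hcost.trans (dual_le_cost hD0 hp hs hs0 hle hx hy hlS)
  have hM0 : ∀ i ∈ Finset.Icc 1 n, 0 ≤ M i := fun i hi =>
    (sub_nonneg.2 (hD (by have := Finset.mem_Icc.1 hi; omega))).trans (hM i hi)
  have hX01 : ∀ i, X i = 0 ∨ X i = 1 := fun i => (hXY i).imp And.left And.left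
  have hY0 : ∀ i, 0 ≤ Y i := by
    intro i
    rcases hXY i with h | ⟨-, v, hv, -, h⟩
    · exact h.2.ge
    · rw [h]
      exact sub_nonneg.2 (hD (by omega))
  have hYM : ∀ i ∈ Finset.Icc 1 n, Y i ≤ M i * X i := by
    intro i hi
    rcases hXY i with h | ⟨h1, v, -, hv, h⟩
    · simp [h]
    · rw [h, h1, mul_one]
      exact (sub_le_sub_right (hD hv) _).trans (hM i hi)
  let X' : ℕ → ℝ := fun i => if i ∈ Finset.Icc 1 n then (if a i < 0 then 1 else X i) else 0
  let Y' : ℕ → ℝ := fun i =>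
    if i ∈ Finset.Icc 1 n then (if q i < 0 then M i * X' i else Y i) else 0
  have hX' : ∀ i ∈ Finset.Icc 1 n, X' i = if a i < 0 then 1 else X i := fun i hi => if_pos hi
  have hY' : ∀ i ∈ Finset.Icc 1 n, Y' i = if q i < 0 then M i * X' i else Y i :=
    fun i hi => if_pos hi
  have hX'01 : ∀ i ∈ Finset.Icc 1 n, X' i = 0 ∨ X' i = 1 := by
    intro i hi
    rw [hX' i hi]
    split_ifs
    · exact Or.inr rfl
    · exact hX01 i
  have hXX' : ∀ i ∈ Finset.Icc 1 n, X i ≤ X' i := by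
    intro i hi
    rw [hX' i hi]
    split_ifs
    · rcases hX01 i with h | h <;> simp [h]
    · exact le_rfl
  have hYMX' : ∀ i ∈ Finset.Icc 1 n, Y i ≤ M i * X' i := fun i hi =>
    (hYM i hi).trans (mul_le_mul_of_nonneg_left (hXX' i hi) (hM0 i hi))
  have hYY' : ∀ i ∈ Finset.Icc 1 n, Y i ≤ Y' i := by
    intro i hi
    rw [hY' i hi]
    split_ifs
    · exact hYMX' i hi
    · exact le_rfl
  refine ⟨X', Y', hX'01, fun i hi => (hY0 i).trans (hYY' i hi), ?_, ?_, ?_, ?_, ?_⟩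
  · intro i hi
    rw [hY' i hi]
    split_ifs
    · exact le_rfl
    · exact hYMX' i hi
  · intro i hi
    rw [hY' i hi]
    split_ifs
    · rcases hX'01 i hi with h | h <;> simp [h]
    · rcases hXY i with h | ⟨-, v, -, hv, h⟩
      · exact Or.inl h.2
      · exact Or.inr (Or.inr ⟨v, hv, h⟩)
  · intro i hi
    exact ⟨if_neg hi, if_neg hi⟩
  · intro t ht
    refine (hcov t (Finset.mem_Icc.1 ht).2).trans (Finset.sum_le_sum fun i hi => hYY' i ?_)
    simp only [Finset.mem_Icc] at ht hi ⊢
    omega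
  · have h1 : ∀ i ∈ Finset.Icc 1 n,
        c i * X' i + q i * Y' i ≤ f i * X i + p i * Y i + min (a i) 0 := by
      intro i hi
      have e : c i * X' i + q i * Y' i = a i * X' i + p i * Y i := by
        rw [hY' i hi]
        by_cases hq : q i < 0
        · simp only [hq, if_true, a, p, min_eq_left hq.le, max_eq_right hq.le]
          ring
        · simp [hq, a, p, min_eq_right (not_lt.1 hq), max_eq_left (not_lt.1 hq)]
      rw [e, hX' i hi]
      by_cases ha : a i < 0
      · simp [ha, f, max_eq_right ha.le, min_eq_left ha.le]
        linarith
      · simp [ha, f, max_eq_left (not_lt.1 ha), min_eq_right (not_lt.1 ha)]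
    have h2 : ∀ i ∈ Finset.Icc 1 n,
        f i * x i + p i * y i + min (a i) 0 ≤ c i * x i + q i * y i := by
      intro i hi
      have e : a i * x i + p i * y i ≤ c i * x i + q i * y i := by
        rcases le_total (q i) 0 with hq | hq
        · simp only [a, p, min_eq_left hq, max_eq_right hq]
          nlinarith [hyM i hi]
        · simp [a, p, min_eq_right hq, max_eq_left hq]
      have e' : f i * x i + min (a i) 0 ≤ a i * x i := by
        rcases le_total (a i) 0 with ha | ha
        · simp only [f, min_eq_left ha, max_eq_right ha]
          nlinarith [hx1 i hi]
        · simp [f, min_eq_right ha, max_eq_left ha]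
      linarith
    have h3 := (Finset.sum_le_sum h1).trans_eq Finset.sum_add_distrib
    have h4 := Finset.sum_add_distrib.symm.trans_le (Finset.sum_le_sum h2)
    linarith

/-! ### The polyhedron of the `(ℓ, S)` inequalities -/

/-- The `(ℓ, S)` inequalities are valid for integral plans. -/
lemma lS_inequality_of_plan {D M x y : ℕ → ℝ} (hD : Monotone D) (hD0 : D 0 = 0) {l : ℕ}
    (hx : ∀ i ∈ Finset.Icc 1 l, x i = 0 ∨ x i = 1) (hy : ∀ i ∈ Finset.Icc 1 l, 0 ≤ y i)
    (hyM : ∀ i ∈ Finset.Icc 1 l, y i ≤ M i * x i)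
    (hcov : ∀ t ∈ Finset.Icc 1 l, D t ≤ ∑ i ∈ Finset.Icc 1 t, y i)
    {S : Finset ℕ} (hS : S ⊆ Finset.Icc 1 l) :
    D l ≤ ∑ i ∈ S, y i + ∑ i ∈ Finset.Icc 1 l \ S, (D l - D (i - 1)) * x i := by
  have hcov' : ∀ t ≤ l, D t ≤ ∑ i ∈ Finset.Icc 1 t, y i := by
    intro t ht
    rcases Nat.eq_zero_or_pos t with rfl | h
    · simp [hD0]
    · exact hcov t (Finset.mem_Icc.2 ⟨h, ht⟩)
  have hy0 : ∀ i ∈ Finset.Icc 1 l, x i = 0 → y i = 0 := fun i hi h =>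
    le_antisymm (by simpa [h] using hyM i hi) (hy i hi)
  have hterm : ∀ i ∈ Finset.Icc 1 l \ S, 0 ≤ (D l - D (i - 1)) * x i := by
    intro i hi
    have hi' := (Finset.mem_sdiff.1 hi).1
    refine mul_nonneg (sub_nonneg.2 (hD ?_)) ?_
    · have := (Finset.mem_Icc.1 hi').2
      omega
    · rcases hx i hi' with h | h <;> simp [h]
  by_cases hex : ∃ i, i ∈ Finset.Icc 1 l \ S ∧ x i = 1
  · classical
    obtain ⟨hk, hxk⟩ := Nat.find_spec hex
    set k := Nat.find hex
    have hk' := Finset.mem_Icc.1 (Finset.mem_sdiff.1 hk).1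
    have h1 : D l - D (k - 1) ≤ ∑ i ∈ Finset.Icc 1 l \ S, (D l - D (i - 1)) * x i := by
      refine le_trans (le_of_eq ?_) (Finset.single_le_sum hterm hk)
      simp [hxk]
    have h2 : ∑ i ∈ Finset.Icc 1 (k - 1), y i ≤ ∑ i ∈ S, y i := by
      rw [← Finset.sum_subset (Finset.inter_subset_left (s₁ := Finset.Icc 1 (k - 1)) (s₂ := S))]
      · exact Finset.sum_le_sum_of_subset_of_nonneg Finset.inter_subset_right
          fun i hi _ => hy i (hS hi)
      · intro i hi hiS
        rw [Finset.mem_Icc] at hi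
        have hil : i ∈ Finset.Icc 1 l := Finset.mem_Icc.2 ⟨hi.1, by omega⟩
        have hiS' : i ∉ S := fun h => hiS (Finset.mem_inter.2 ⟨Finset.mem_Icc.2 hi, h⟩)
        have hlt : i < Nat.find hex := by
          change i < k
          omega
        refine hy0 i hil ((hx i hil).resolve_right fun h => Nat.find_min hex hlt ?_)
        exact ⟨Finset.mem_sdiff.2 ⟨hil, hiS'⟩, h⟩
    have h3 := hcov' (k - 1) (by omega)
    linarith
  · push Not at hex
    have h1 : ∑ i ∈ Finset.Icc 1 l, y i = ∑ i ∈ S, y i := by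
      refine (Finset.sum_subset hS fun i hi hiS => hy0 i hi ?_).symm
      exact (hx i hi).resolve_right (hex i (Finset.mem_sdiff.2 ⟨hi, hiS⟩))
    have := hcov' l le_rfl
    have := Finset.sum_nonneg hterm
    linarith

/-- Points of the lot-sizing space supported on finitely many periods, with all coordinates in
prescribed finite sets, form a finite set. -/
lemma finite_supported_points (n : ℕ) {F G : ℕ → Set ℝ} (hF : ∀ i, (F i).Finite)
    (hG : ∀ i, (G i).Finite) :
    {w : (ℕ → ℝ) × (ℕ → ℝ) × (ℕ → ℝ) |
      (∀ i ∈ Finset.Icc 1 n, w.1 i ∈ F i ∧ w.2.1 i ∈ G i) ∧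
      (∀ i, i ∉ Finset.Icc 1 n → w.1 i = 0 ∧ w.2.1 i = 0) ∧ w.2.2 = 0}.Finite := by
  let φ : (ℕ → ℝ) × (ℕ → ℝ) × (ℕ → ℝ) → Finset.Icc 1 n → ℝ × ℝ :=
    fun w i => (w.1 i, w.2.1 i)
  refine Set.Finite.of_injOn (f := φ)
    (t := Set.pi Set.univ fun i : Finset.Icc 1 n => F i ×ˢ G i) ?_ ?_
    (Set.Finite.pi fun i : Finset.Icc 1 n => (hF i).prod (hG i))
  · intro w hw i _
    exact hw.1 i i.2
  · rintro ⟨x, y, z⟩ ⟨-, hw, hz⟩ ⟨x', y', z'⟩ ⟨-, hw', hz'⟩ h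
    have key : ∀ i, x i = x' i ∧ y i = y' i := by
      intro i
      by_cases hi : i ∈ Finset.Icc 1 n
      · exact Prod.ext_iff.1 (congrFun h ⟨i, hi⟩)
      · have h1 := hw i hi
        have h2 := hw' i hi
        exact ⟨h1.1.trans h2.1.symm, h1.2.trans h2.2.symm⟩
    have hx : x = x' := funext fun i => (key i).1
    have hy : y = y' := funext fun i => (key i).2
    have hzz : z = z' := Eq.trans hz (Eq.symm hz')
    rw [hx, hy, hzz]

/-- A linear functional on points supported on the first `n` periods, in coordinates. -/
lemma linear_apply_eq_sum (f : ((ℕ → ℝ) × (ℕ → ℝ) × (ℕ → ℝ)) →ₗ[ℝ] ℝ) {n : ℕ} {x y : ℕ → ℝ}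
    (h : ∀ i, i ∉ Finset.Icc 1 n → x i = 0 ∧ y i = 0) :
    f (x, y, 0) = ∑ i ∈ Finset.Icc 1 n,
      (f (Pi.single i 1, 0, 0) * x i + f (0, Pi.single i 1, 0) * y i) := by
  have hsum : ∀ v : ℕ → ℝ, (∀ i, i ∉ Finset.Icc 1 n → v i = 0) →
      v = ∑ i ∈ Finset.Icc 1 n, v i • (Pi.single i 1 : ℕ → ℝ) := by
    intro v hv
    ext l
    simp only [Finset.sum_apply, Pi.smul_apply, Pi.single_apply, smul_eq_mul, mul_ite, mul_one,
      mul_zero, Finset.sum_ite_eq]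
    by_cases hl : l ∈ Finset.Icc 1 n
    · rw [if_pos hl]
    · rw [if_neg hl, hv l hl]
  have e : ((x, y, 0) : (ℕ → ℝ) × (ℕ → ℝ) × (ℕ → ℝ)) = ∑ i ∈ Finset.Icc 1 n,
      (x i • ((Pi.single i 1, 0, 0) : (ℕ → ℝ) × (ℕ → ℝ) × (ℕ → ℝ)) +
        y i • ((0, Pi.single i 1, 0) : (ℕ → ℝ) × (ℕ → ℝ) × (ℕ → ℝ))) := by
    refine Prod.ext ?_ (Prod.ext ?_ ?_)
    · simpa [Prod.fst_sum] using hsum x fun i hi => (h i hi).1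
    · simpa [Prod.fst_sum, Prod.snd_sum] using hsum y fun i hi => (h i hi).2
    · simp [Prod.snd_sum]
  rw [e, map_sum]
  refine Finset.sum_congr rfl fun i _ => ?_
  rw [map_add, map_smul, map_smul, smul_eq_mul, smul_eq_mul]
  ring

/-- The polyhedron of the `(ℓ, S)` inequalities with `y i ≤ M i * x i` is convex. -/
lemma convex_lS_polyhedron (n : ℕ) (M : ℕ → ℝ) (b : ℕ → ℝ) (a : ℕ → ℕ → ℝ) :
    Convex ℝ {w : (ℕ → ℝ) × (ℕ → ℝ) × (ℕ → ℝ) |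
        (∀ i ∈ Finset.Icc 1 n,
          0 ≤ w.1 i ∧ w.1 i ≤ 1 ∧ 0 ≤ w.2.1 i ∧ w.2.1 i ≤ M i * w.1 i) ∧
        (∀ j, w.2.2 j = 0) ∧
        (∀ i, i ∉ Finset.Icc 1 n → w.1 i = 0 ∧ w.2.1 i = 0) ∧
        (∀ ℓ ∈ Finset.Icc 1 n, ∀ S ⊆ Finset.Icc 1 ℓ,
          b ℓ ≤ ∑ i ∈ S, w.2.1 i + ∑ i ∈ Finset.Icc 1 ℓ \ S, a ℓ i * w.1 i)} := by
  rintro ⟨x, y, z⟩ ⟨hw1, hw2, hw3, hw4⟩ ⟨x', y', z'⟩ ⟨hw1', hw2', hw3', hw4'⟩ α β hα hβ hαβ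
  dsimp only at *
  simp only [Set.mem_ofPred_eq, Prod.smul_mk, Prod.mk_add_mk, Pi.add_apply, Pi.smul_apply,
    smul_eq_mul]
  refine ⟨fun i hi => ?_, fun j => by simp [hw2, hw2'], fun i hi => by
    simp [hw3 i hi, hw3' i hi], fun l hl S hS => ?_⟩
  · obtain ⟨h1, h2, h3, h4⟩ := hw1 i hi
    obtain ⟨h1', h2', h3', h4'⟩ := hw1' i hi
    refine ⟨by positivity, ?_, by positivity, ?_⟩
    · linarith [mul_le_mul_of_nonneg_left h2 hα, mul_le_mul_of_nonneg_left h2' hβ]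
    · linarith [mul_le_mul_of_nonneg_left h4 hα, mul_le_mul_of_nonneg_left h4' hβ]
  · have h := mul_le_mul_of_nonneg_left (hw4 l hl S hS) hα
    have h' := mul_le_mul_of_nonneg_left (hw4' l hl S hS) hβ
    have e : α * b l + β * b l = b l := by rw [← add_mul, hαβ, one_mul]
    refine le_trans (le_of_eq e.symm) ((add_le_add h h').trans (le_of_eq ?_))
    simp only [mul_add, Finset.mul_sum, Finset.sum_add_distrib]
    have e1 : ∀ i, a l i * (α * x i) = α * (a l i * x i) := fun i => by ring
    have e2 : ∀ i, a l i * (β * x' i) = β * (a l i * x' i) := fun i => by ring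
    simp only [e1, e2]
    ring

/-- when `k = 0` (i.e. `ε = 0`), the proposed inequalities, together with the
trivial bounds and `z = 0`, give the complete linear description of `conv(P)`.
Here `D_{σ_{ℓ(1)}}` is the largest cumulative demand through period `ℓ`, and for `i = 1`
the coefficient uses `D_{σ_{0(1)}} = cumD d _ 0 = 0`. -/
theorem convex_hull_eps_zero (n m : ℕ) (hn : 1 ≤ n) (hm : 1 ≤ m)
    (d : ℕ → ℕ → ℝ)
    (hd : ∀ j ∈ Finset.Icc 1 m, ∀ i ∈ Finset.Icc 1 n, 0 ≤ d j i)
    (σ : ℕ → ℕ → ℕ)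
    (hσbij : ∀ i ∈ Finset.Icc 1 n, Set.BijOn (σ i) (Set.Icc 1 m) (Set.Icc 1 m))
    (hσord : ∀ i ∈ Finset.Icc 1 n, ∀ p q, 1 ≤ p → p ≤ q → q ≤ m →
      cumD d (σ i q) i ≤ cumD d (σ i p) i) :
    convexHull ℝ (Pset d n m 0) =
      {w : (ℕ → ℝ) × (ℕ → ℝ) × (ℕ → ℝ) |
        (∀ i ∈ Finset.Icc 1 n,
          0 ≤ w.1 i ∧ w.1 i ≤ 1 ∧ 0 ≤ w.2.1 i ∧ w.2.1 i ≤ bigM d n m i * w.1 i) ∧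
        (∀ j, w.2.2 j = 0) ∧
        (∀ i, i ∉ Finset.Icc 1 n → w.1 i = 0 ∧ w.2.1 i = 0) ∧
        (∀ ℓ ∈ Finset.Icc 1 n, ∀ S ⊆ Finset.Icc 1 ℓ,
          cumD d (σ ℓ 1) ℓ ≤
            ∑ i ∈ S, w.2.1 i +
            ∑ i ∈ Finset.Icc 1 ℓ \ S,
              (cumD d (σ ℓ 1) ℓ - cumD d (σ (i - 1) 1) (i - 1)) * w.1 i)} := by
  have hm1 : 1 ∈ Set.Icc 1 m := ⟨le_rfl, hm⟩
  let D : ℕ → ℝ := fun t => cumD d (σ (min t n) 1) (min t n)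
  have hDeq : ∀ t ≤ n, D t = cumD d (σ t 1) t := fun t ht => by simp only [D, min_eq_left ht]
  have hcum0 : ∀ j, cumD d j 0 = 0 := fun j => by simp [cumD]
  have hD0 : D 0 = 0 := by rw [hDeq 0 (Nat.zero_le n), hcum0]
  have hle : ∀ t ≤ n, ∀ j ∈ Finset.Icc 1 m, cumD d j t ≤ D t := by
    intro t ht j hj
    rcases Nat.eq_zero_or_pos t with rfl | htpos
    · rw [hD0, hcum0]
    · have htn := Finset.mem_Icc.2 ⟨htpos, ht⟩
      obtain ⟨q, hq, rfl⟩ := (hσbij t htn).surjOn (Finset.mem_Icc.1 hj)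
      rw [hDeq t ht]
      exact hσord t htn 1 q le_rfl hq.1 hq.2
  have hatt : ∀ t ≤ n, ∃ j ∈ Finset.Icc 1 m, D t = cumD d j t := by
    intro t ht
    rcases Nat.eq_zero_or_pos t with rfl | htpos
    · exact ⟨1, Finset.mem_Icc.2 hm1, by rw [hD0, hcum0]⟩
    · exact ⟨σ t 1, Finset.mem_Icc.2 ((hσbij t (Finset.mem_Icc.2 ⟨htpos, ht⟩)).mapsTo hm1),
        hDeq t ht⟩
  have hD : Monotone D := by
    intro a b hab
    obtain ⟨j, hj, ha⟩ := hatt (min a n) (min_le_right _ _)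
    have ea : D a = D (min a n) := by simp [D]
    have eb : D b = D (min b n) := by simp [D]
    rw [ea, ha, eb]
    refine le_trans ?_ (hle (min b n) (min_le_right _ _) j hj)
    refine Finset.sum_le_sum_of_subset_of_nonneg
      (Finset.Icc_subset_Icc_right (min_le_min hab le_rfl)) fun i hi _ => hd j hj i ?_
    simp only [Finset.mem_Icc] at hi ⊢
    omega
  have hM : ∀ i ∈ Finset.Icc 1 n, D n - D (i - 1) ≤ bigM d n m i := by
    intro i hi
    rw [Finset.mem_Icc] at hi
    obtain ⟨j, hj, hjn⟩ := hatt n le_rfl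
    have h1 := hle (i - 1) (by omega) j hj
    have h2 : ∑ p ∈ Finset.Icc i n, d j p ≤ bigM d n m i :=
      le_csSup ((Set.finite_Icc 1 m).image _).bddAbove ⟨j, Finset.mem_Icc.1 hj, rfl⟩
    have h3 : cumD d j n = cumD d j (i - 1) + ∑ p ∈ Finset.Icc i n, d j p :=
      sum_Icc_one_split (d j) hi.1 (by omega)
    linarith
  have hcoef : ∀ l ∈ Finset.Icc 1 n, ∀ S : Finset ℕ, ∀ x : ℕ → ℝ,
      ∑ i ∈ Finset.Icc 1 l \ S, (cumD d (σ l 1) l - cumD d (σ (i - 1) 1) (i - 1)) * x i =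
        ∑ i ∈ Finset.Icc 1 l \ S, (D l - D (i - 1)) * x i := by
    intro l hl S x
    refine Finset.sum_congr rfl fun i hi => ?_
    have hi' := Finset.mem_Icc.1 (Finset.mem_sdiff.1 hi).1
    rw [Finset.mem_Icc] at hl
    rw [hDeq l hl.2, hDeq (i - 1) (by omega)]
  refine Set.Subset.antisymm (convexHull_min ?_ (convex_lS_polyhedron n _ _ _)) ?_
  · rintro ⟨x, y, z⟩ ⟨⟨hx, hy, hz, hcov, hzk, hyM⟩, hxy0, hz0⟩
    dsimp only at hx hy hz hcov hzk hyM hxy0 hz0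
    have hz' : ∀ j, z j = 0 := by
      intro j
      by_cases hj : j ∈ Finset.Icc 1 m
      · have hnn : ∀ j ∈ Finset.Icc 1 m, 0 ≤ z j := fun j hj => by
          rcases hz j hj with h | h <;> simp [h]
        have h1 := Finset.single_le_sum hnn hj
        have h2 := hnn j hj
        simp only [Nat.cast_zero] at hzk
        linarith
      · exact hz0 j hj
    refine ⟨fun i hi => ⟨?_, ?_, hy i hi, hyM i hi⟩, hz', hxy0, fun l hl S hS => ?_⟩
    · rcases hx i hi with h | h <;> simp [h]
    · rcases hx i hi with h | h <;> simp [h]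
    · have hsub : Finset.Icc 1 l ⊆ Finset.Icc 1 n :=
        Finset.Icc_subset_Icc_right (Finset.mem_Icc.1 hl).2
      dsimp only
      rw [hcoef l hl S x, ← hDeq l (Finset.mem_Icc.1 hl).2]
      refine lS_inequality_of_plan hD hD0 (fun i hi => hx i (hsub hi)) (fun i hi => hy i (hsub hi))
        (fun i hi => hyM i (hsub hi)) (fun t ht => ?_) hS
      obtain ⟨j, hj, hjt⟩ := hatt t (Finset.mem_Icc.1 (hsub ht)).2
      have := hcov t (hsub ht) j hj
      rwa [hz' j, sub_zero, mul_one, ← hjt] at this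
  · rintro ⟨x, y, z⟩ ⟨hbd, hz, hxy0, hlS⟩
    dsimp only at hbd hz hxy0 hlS
    obtain rfl : z = 0 := funext hz
    let V : Set ((ℕ → ℝ) × (ℕ → ℝ) × (ℕ → ℝ)) := Pset d n m 0 ∩
      {w | (∀ i ∈ Finset.Icc 1 n, w.1 i ∈ ({0, 1} : Set ℝ) ∧
          w.2.1 i ∈ {0, bigM d n m i} ∪ (fun v => D v - D (i - 1)) '' Set.Iic n) ∧
        (∀ i, i ∉ Finset.Icc 1 n → w.1 i = 0 ∧ w.2.1 i = 0) ∧ w.2.2 = 0}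
    have hV : V.Finite := (finite_supported_points n (fun _ => Set.toFinite {0, 1})
      (fun i => (Set.toFinite {0, bigM d n m i}).union ((Set.finite_Iic n).image _))).subset
        Set.inter_subset_right
    refine convexHull_mono (Set.inter_subset_left : V ⊆ _) ?_
    by_contra hnot
    obtain ⟨f, u, hfu, hfV⟩ := geometric_hahn_banach_point_closed (convex_convexHull ℝ V)
      (hV.isClosed_convexHull ℝ) hnot
    obtain ⟨X, Y, hX, hY, hYM, hYF, hXY0, hcov, hcost⟩ := exists_plan_le hD hD0 hM
      (fun i => f (Pi.single i 1, 0, 0)) (fun i => f (0, Pi.single i 1, 0))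
      (fun i hi => (hbd i hi).1) (fun i hi => (hbd i hi).2.1) (fun i hi => (hbd i hi).2.2.1)
      (fun i hi => (hbd i hi).2.2.2) (fun l hl S hS => by
        have := hlS l hl S hS
        rwa [hcoef l hl S x, ← hDeq l (Finset.mem_Icc.1 hl).2] at this)
    have hmem : ((X, Y, 0) : (ℕ → ℝ) × (ℕ → ℝ) × (ℕ → ℝ)) ∈ V := by
      refine ⟨⟨⟨hX, hY, fun j _ => Or.inl rfl, fun t ht j hj => ?_, by simp, hYM⟩, hXY0,
        fun j _ => rfl⟩, fun i hi => ⟨hX i hi, ?_⟩, hXY0, rfl⟩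
      · simp only [Pi.zero_apply, sub_zero, mul_one]
        exact (hle t (Finset.mem_Icc.1 ht).2 j hj).trans (hcov t ht)
      · rcases hYF i hi with h | h | ⟨v, hv, h⟩
        · exact Or.inl (Or.inl h)
        · exact Or.inl (Or.inr h)
        · exact Or.inr ⟨v, hv, h.symm⟩
    have h1 := hfV _ (subset_convexHull ℝ V hmem)
    have h2 := linear_apply_eq_sum (f : ((ℕ → ℝ) × (ℕ → ℝ) × (ℕ → ℝ)) →ₗ[ℝ] ℝ) hXY0
    have h3 := linear_apply_eq_sum (f : ((ℕ → ℝ) × (ℕ → ℝ) × (ℕ → ℝ)) →ₗ[ℝ] ℝ) hxy0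
    simp only [ContinuousLinearMap.coe_coe] at h2 h3
    linarith

end
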